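/- The triangulation Δ of the d-braxtope Q^{d,n} with maximal simplices J_i = [x_0, x_i, ..., x_{i+d-1}] (1 ≤ i ≤ n-d+1) is shallow: every k-dimensional face of Δ is contained in a face of Q of dimension at most 2k. -/

import Mathlib

open Set

noncomputable section

variable {V : Type*} [NormedAddCommGroup V] [NormedSpace ℝ V]

open Classical in
/-- Affine dimension of a set: `-1` for the empty set, otherwise the
dimension of its affine hull. -/
def sdim (s : Set V) : ℤ :=
  if s.Nonempty then (Module.finrank ℝ (affineSpan ℝ s).direction : ℤ) else -1

/-- `F` is a face of the polytope `Q`. -/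
def IsFaceOf (Q F : Set V) : Prop :=
  IsExtreme ℝ Q F ∧ Convex ℝ F ∧ IsClosed F

/-- `F` is a facet of the `d`-polytope `Q`. -/
def IsFacetOf (d : ℕ) (Q F : Set V) : Prop :=
  IsFaceOf Q F ∧ sdim F = (d : ℤ) - 1

/-- The segment `[a, b]` is an edge (a 1-dimensional face) of `Q`. -/
def IsEdgeOf (Q : Set V) (a b : V) : Prop :=
  IsFaceOf Q (segment ℝ a b) ∧ sdim (segment ℝ a b) = 1

/-- Clamped vertex indexing: `x_t = x_0` for `t ≤ 0` and `x_t = x_n` for `t ≥ n`. -/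
def xc {n : ℕ} (x : Fin (n + 1) → V) (t : ℤ) : V :=
  x ⟨(min (max t 0) n).toNat, by omega⟩

/-- The polytope spanned by the vertex array `x`. -/
def braxQ {n : ℕ} (x : Fin (n + 1) → V) : Set V :=
  convexHull ℝ (Set.range x)

/-- Vertex set of the simplex facet `T_i = [x_i, …, x_{i+d-1}]`. -/
def Tset (d : ℕ) {n : ℕ} (x : Fin (n + 1) → V) (i : ℤ) : Set V :=
  xc x '' Set.Icc i (i + (d : ℤ) - 1)

/-- Vertex set of the facet
`E_j = [x_0, x_{j-(d-2)}, …, x_{j-1}, x_{j+1}, …, x_{j+(d-2)}]`. -/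
def Eset (d : ℕ) {n : ℕ} (x : Fin (n + 1) → V) (j : ℤ) : Set V :=
  insert (x 0) (xc x '' (Set.Icc (j - ((d : ℤ) - 2)) (j + ((d : ℤ) - 2)) \ {j}))

/-- `x_0 < x_1 < ⋯ < x_n` is the vertex array of a `d`-braxtope: for `d ≤ 2` a
`d`-simplex; for `d ≥ 3` a `d`-polytope whose facets are exactly the `T_i`
(`0 ≤ i ≤ n - d + 1`) and the `E_j` (`2 ≤ j ≤ n`). -/
def IsBraxtope (d n : ℕ) (x : Fin (n + 1) → V) : Prop :=
  (d ≤ 2 → n = d ∧ AffineIndependent ℝ x) ∧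
  (3 ≤ d →
    d ≤ n ∧ Function.Injective x ∧
    sdim (braxQ x) = d ∧
    (∀ i, x i ∈ Set.extremePoints ℝ (braxQ x)) ∧
    (∀ F : Set V, IsFacetOf d (braxQ x) F ↔
      (∃ i : ℤ, 0 ≤ i ∧ i ≤ (n : ℤ) - d + 1 ∧ F = convexHull ℝ (Tset d x i)) ∨
      (∃ j : ℤ, 2 ≤ j ∧ j ≤ (n : ℤ) ∧ F = convexHull ℝ (Eset d x j))))


/-- The simplex `J_i = [x_0, x_i, x_{i+1}, …, x_{i+d-1}]` of the pulling
triangulation of the braxtope at `x_0`. -/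
def Jverts (d : ℕ) {n : ℕ} (x : Fin (n + 1) → V) (i : ℤ) : Set V :=
  insert (x 0) (xc x '' Set.Icc i (i + (d : ℤ) - 1))

def Jset (d : ℕ) {n : ℕ} (x : Fin (n + 1) → V) (i : ℤ) : Set V :=
  convexHull ℝ (Jverts d x i)

lemma brax_sdim_nonempty {s : Set V} (h : s.Nonempty) :
    sdim s = (Module.finrank ℝ (affineSpan ℝ s).direction : ℤ) := by
  simp [sdim, h]

lemma brax_sdim_hull (s : Set V) : sdim (convexHull ℝ s) = sdim s := by
  unfold sdim
  rw [affineSpan_convexHull, convexHull_nonempty_iff]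

lemma brax_comb {F : Set V} (hF : Convex ℝ F) {a b : ℝ} (ha : 0 ≤ a) (hb : 0 ≤ b) {p q : V}
    (hp : p ∈ F) (hq : q ∈ F) : ∃ r ∈ F, a • p + b • q = (a + b) • r := by
  rcases (add_nonneg ha hb).eq_or_lt with h | h
  · have h1 : a = 0 := by linarith
    have h2 : b = 0 := by linarith
    exact ⟨p, hp, by simp [h1, h2]⟩
  · refine ⟨(a / (a + b)) • p + (b / (a + b)) • q,
      hF hp hq (by positivity) (by positivity) (by field_simp), ?_⟩
    rw [smul_add, smul_smul, smul_smul, mul_div_cancel₀ _ h.ne', mul_div_cancel₀ _ h.ne']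

lemma brax_comb3 {F : Set V} (hF : Convex ℝ F) {a b c : ℝ} (ha : 0 ≤ a) (hb : 0 ≤ b)
    (hc : 0 ≤ c) {p q s : V} (hp : p ∈ F) (hq : q ∈ F) (hs : s ∈ F) :
    ∃ r ∈ F, a • p + b • q + c • s = (a + b + c) • r := by
  obtain ⟨r, hr, h⟩ := brax_comb hF ha hb hp hq
  obtain ⟨r', hr', h'⟩ := brax_comb hF (add_nonneg ha hb) hc hr hs
  exact ⟨r', hr', by rw [h, h']⟩

lemma brax_span_rep {F : Set V} (hF : Convex ℝ F) {v : V} (hv : v ∈ affineSpan ℝ F) :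
    ∃ t : ℝ, 0 ≤ t ∧ ∃ p ∈ F, ∃ q ∈ F, v = (1 + t) • p - t • q := by
  refine affineSpan_induction hv (fun x hx => ⟨0, le_rfl, x, hx, x, hx, by simp⟩) ?_
  · intro c u v w hu hv hw
    obtain ⟨t1, ht1, p1, hp1, q1, hq1, rfl⟩ := hu
    obtain ⟨t2, ht2, p2, hp2, q2, hq2, rfl⟩ := hv
    obtain ⟨t3, ht3, p3, hp3, q3, hq3, rfl⟩ := hw
    rcases le_total 0 c with hc | hc
    · obtain ⟨r, hr, h⟩ := brax_comb3 hF (a := c * (1 + t1)) (b := c * t2) (c := 1 + t3)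
        (by positivity) (by positivity) (by positivity) hp1 hq2 hp3
      obtain ⟨r', hr', h'⟩ := brax_comb3 hF (a := c * t1) (b := c * (1 + t2)) (c := t3)
        (by positivity) (by positivity) (by positivity) hq1 hp2 hq3
      refine ⟨c * t1 + c * (1 + t2) + t3, by positivity, r, hr, r', hr', ?_⟩
      rw [← h', show (1 + (c * t1 + c * (1 + t2) + t3)) = c * (1 + t1) + c * t2 + (1 + t3) by ring,
        ← h]
      simp only [vsub_eq_sub, vadd_eq_add]
      module
    · obtain ⟨e, rfl⟩ : ∃ e, c = -e := ⟨-c, by ring⟩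
      have he : 0 ≤ e := by linarith
      obtain ⟨r, hr, h⟩ := brax_comb3 hF (a := e * (1 + t2)) (b := e * t1) (c := 1 + t3)
        (by positivity) (by positivity) (by positivity) hp2 hq1 hp3
      obtain ⟨r', hr', h'⟩ := brax_comb3 hF (a := e * t2) (b := e * (1 + t1)) (c := t3)
        (by positivity) (by positivity) (by positivity) hq2 hp1 hq3
      refine ⟨e * t2 + e * (1 + t1) + t3, by positivity, r, hr, r', hr', ?_⟩
      rw [← h', show (1 + (e * t2 + e * (1 + t1) + t3)) = e * (1 + t2) + e * t1 + (1 + t3) by ring,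
        ← h]
      simp only [vsub_eq_sub, vadd_eq_add]
      module

/-- A convex extreme subset is cut out by its affine span. -/
lemma brax_mem_of_span {A F : Set V} (hF : Convex ℝ F) (hE : IsExtreme ℝ A F) {v : V}
    (hvA : v ∈ A) (hv : v ∈ affineSpan ℝ F) : v ∈ F := by
  obtain ⟨t, ht, p, hp, q, hq, rfl⟩ := brax_span_rep hF hv
  rcases ht.eq_or_lt with rfl | ht
  · simpa using hp
  · refine hE.left_mem_of_mem_openSegment hvA (hE.subset hq) hp ?_
    refine ⟨1 / (1 + t), t / (1 + t), by positivity, by positivity, by field_simp, ?_⟩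
    rw [smul_sub, smul_smul, smul_smul, one_div_mul_cancel (by positivity), one_smul,
      one_div_mul_eq_div]
    abel

lemma brax_drop {A F G : Set V} (hF : Convex ℝ F) (hE : IsExtreme ℝ A F) (hG : G ⊆ A)
    (hFG : F ⊆ G) {v : V} (hvG : v ∈ G) (hvF : v ∉ F)
    [FiniteDimensional ℝ (affineSpan ℝ G).direction] : sdim F + 1 ≤ sdim G := by
  rw [brax_sdim_nonempty ⟨v, hvG⟩]
  rcases F.eq_empty_or_nonempty with rfl | hne
  · simp [sdim]
  rw [brax_sdim_nonempty hne]
  have hlt : affineSpan ℝ F < affineSpan ℝ G := by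
    refine lt_of_le_of_ne (affineSpan_mono ℝ hFG) fun h => hvF ?_
    exact brax_mem_of_span hF hE (hG hvG) (h ▸ subset_affineSpan ℝ G hvG)
  have h2 := AffineSubspace.direction_lt_of_nonempty hlt (hne.mono (subset_affineSpan ℝ F))
  have := Submodule.finrank_lt_finrank_of_lt h2
  omega

lemma brax_fd {Q G : Set V} (hQ : FiniteDimensional ℝ (affineSpan ℝ Q).direction) (h : G ⊆ Q) :
    FiniteDimensional ℝ (affineSpan ℝ G).direction :=
  Submodule.finiteDimensional_of_le (AffineSubspace.direction_le (affineSpan_mono ℝ h))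

lemma brax_indep_sdim {T : Set V} (hf : T.Finite) (hne : T.Nonempty)
    (h : AffineIndependent ℝ ((↑) : T → V)) : sdim T = (T.ncard : ℤ) - 1 := by
  have := hf.fintype
  have hc : Fintype.card T = (T.ncard - 1) + 1 := by
    have := (Set.ncard_pos hf).2 hne
    rw [Fintype.card_eq_nat_card, Nat.card_coe_set_eq]; omega
  have := h.finrank_vectorSpan hc
  rw [Subtype.range_coe] at this
  rw [brax_sdim_nonempty hne, direction_affineSpan, this]
  have := (Set.ncard_pos hf).2 hne
  omega

lemma brax_indep_of_sdim {T : Set V} (hf : T.Finite) (hne : T.Nonempty)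
    (h : (T.ncard : ℤ) - 1 ≤ sdim T) : AffineIndependent ℝ ((↑) : T → V) := by
  have := hf.fintype
  have hp := (Set.ncard_pos hf).2 hne
  have hc : Fintype.card T = (T.ncard - 1) + 1 := by
    rw [Fintype.card_eq_nat_card, Nat.card_coe_set_eq]; omega
  rw [affineIndependent_iff_le_finrank_vectorSpan ℝ _ hc, Subtype.range_coe]
  rw [brax_sdim_nonempty hne, direction_affineSpan] at h
  omega

lemma brax_simplex_face {T S : Set V} (hf : T.Finite) (h : AffineIndependent ℝ ((↑) : T → V))
    (hS : S ⊆ T) : IsExtreme ℝ (convexHull ℝ T) (convexHull ℝ S) := by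
  classical
  obtain ⟨T, rfl⟩ := hf.exists_finset_coe
  obtain ⟨S, rfl⟩ := (hf.subset hS).exists_finset_coe
  have hS' : S ⊆ T := by exact_mod_cast hS
  refine ⟨convexHull_mono hS, ?_⟩
  intro x hx y hy z hz hzs
  rw [Finset.mem_convexHull'] at hx hy hz ⊢
  obtain ⟨wx, hx0, hx1, hx2⟩ := hx
  obtain ⟨wy, hy0, hy1, hy2⟩ := hy
  obtain ⟨wz, hz0, hz1, hz2⟩ := hz
  obtain ⟨a, b, ha, hb, hab, hzz⟩ := hzs
  have key : ∀ t ∈ T, a * wx t + b * wy t - (if t ∈ S then wz t else 0) = 0 := by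
    have h : AffineIndependent ℝ (fun t : {t // t ∈ T} => (t : V)) := h
    rw [affineIndependent_iff] at h
    have := h Finset.univ
      (fun t => a * wx t + b * wy t - (if (t : V) ∈ S then wz t else 0)) ?_ ?_
    · intro t ht
      exact this ⟨t, ht⟩ (Finset.mem_univ _)
    · rw [Finset.sum_coe_sort T
        (fun t => a * wx t + b * wy t - (if (t : V) ∈ S then wz t else 0))]
      rw [Finset.sum_sub_distrib, Finset.sum_add_distrib, ← Finset.mul_sum, ← Finset.mul_sum,
        hx1, hy1, Finset.sum_ite_mem, Finset.inter_eq_right.2 hS', hz1]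
      linarith
    · rw [Finset.sum_coe_sort T
        (fun t => (a * wx t + b * wy t - (if (t : V) ∈ S then wz t else 0)) • t)]
      simp only [sub_smul, add_smul, mul_smul, ite_smul, zero_smul]
      rw [Finset.sum_sub_distrib, Finset.sum_add_distrib, ← Finset.smul_sum, ← Finset.smul_sum,
        hx2, hy2, Finset.sum_ite_mem, Finset.inter_eq_right.2 hS', hz2, hzz, sub_self]
  have hzero : ∀ t ∈ T, t ∉ S → wx t = 0 := by
    intro t ht hts
    have h1 := key t ht
    rw [if_neg hts] at h1
    have h2 := mul_nonneg hb.le (hy0 t ht)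
    have h3 := mul_nonneg ha.le (hx0 t ht)
    have h4 : a * wx t = 0 := by linarith
    exact (mul_eq_zero.1 h4).resolve_left ha.ne'
  refine ⟨wx, fun t ht => hx0 t (hS' ht), ?_, ?_⟩
  · rw [← hx1]
    exact Finset.sum_subset hS' hzero
  · rw [← hx2]
    exact Finset.sum_subset hS' fun t ht hts => by rw [hzero t ht hts, zero_smul]

lemma brax_xc_inj {n : ℕ} {x : Fin (n + 1) → V} (hinj : Function.Injective x) {s t : ℤ} :
    xc x s = xc x t ↔ min (max s 0) (n : ℤ) = min (max t 0) n := by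
  unfold xc
  rw [hinj.eq_iff, Fin.mk.injEq]
  omega

lemma brax_x0 {n : ℕ} (x : Fin (n + 1) → V) : x 0 = xc x 0 := by
  unfold xc
  congr 1

lemma brax_xc_mem {n : ℕ} (x : Fin (n + 1) → V) (t : ℤ) : xc x t ∈ braxQ x :=
  subset_convexHull ℝ _ ⟨_, rfl⟩

lemma brax_notMem {A s : Set V} (hs : convexHull ℝ s ⊆ A) {v : V} (hv : v ∈ A.extremePoints ℝ)
    (h : v ∉ s) : v ∉ convexHull ℝ s := fun hc =>
  h (extremePoints_convexHull_subset
    (inter_extremePoints_subset_extremePoints_of_subset hs ⟨hc, hv⟩))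

lemma brax_faceQ {n : ℕ} (x : Fin (n + 1) → V) : IsFaceOf (braxQ x) (braxQ x) :=
  ⟨IsExtreme.rfl, convex_convexHull ℝ _, (Set.finite_range x).isClosed_convexHull ℝ⟩

lemma brax_face_inter {Q F G : Set V} (hF : IsFaceOf Q F) (hG : IsFaceOf Q G) :
    IsFaceOf Q (F ∩ G) :=
  ⟨hF.1.inter hG.1, hF.2.1.inter hG.2.1, hF.2.2.inter hG.2.2⟩

lemma brax_fdQ {n : ℕ} (x : Fin (n + 1) → V) :
    FiniteDimensional ℝ (affineSpan ℝ (braxQ x)).direction := by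
  unfold braxQ
  rw [affineSpan_convexHull, direction_affineSpan]
  exact finiteDimensional_vectorSpan_of_finite ℝ (Set.finite_range x)

/-- Cutting a face by another face that misses one of its points drops the dimension. -/
lemma brax_cut {n : ℕ} {x : Fin (n + 1) → V} {F G : Set V} (hF : IsFaceOf (braxQ x) F)
    (hG : IsFaceOf (braxQ x) G) {v : V} (hv : v ∈ G) (hvF : v ∉ F) :
    sdim (G ∩ F) + 1 ≤ sdim G := by
  have := brax_fd (brax_fdQ x) hG.1.subset
  exact brax_drop (brax_face_inter hG hF).2.1 (brax_face_inter hG hF).1 hG.1.subset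
    Set.inter_subset_left hv (fun h => hvF h.2)

lemma brax_memE {d n : ℕ} (x : Fin (n + 1) → V) {j t : ℤ} (h1 : t ≠ j)
    (h2 : t - j ≤ (d : ℤ) - 2) (h3 : j - t ≤ (d : ℤ) - 2) : xc x t ∈ Eset d x j := by
  refine Or.inr ⟨t, ⟨⟨by omega, by omega⟩, h1⟩, rfl⟩

lemma brax_notMemE {d n : ℕ} {x : Fin (n + 1) → V} (hinj : Function.Injective x) {j : ℤ}
    (h1 : 1 ≤ j) (h2 : j ≤ (n : ℤ) - 1) : xc x j ∉ Eset d x j := by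
  rintro (h | ⟨s, ⟨_, hs⟩, h⟩)
  · rw [brax_x0 x, brax_xc_inj hinj] at h
    omega
  · rw [brax_xc_inj hinj] at h
    apply hs
    simp only [Set.mem_singleton_iff]
    omega

lemma brax_window {d n : ℕ} {x : Fin (n + 1) → V} (hd : 3 ≤ d) (hinj : Function.Injective x)
    (hdim : sdim (braxQ x) = d)
    (hext : ∀ i, x i ∈ Set.extremePoints ℝ (braxQ x))
    (hE : ∀ j : ℤ, 2 ≤ j → j ≤ n → IsFaceOf (braxQ x) (convexHull ℝ (Eset d x j)))
    (I : Finset ℤ) : (∀ j ∈ I, 2 ≤ j ∧ j ≤ (n : ℤ) - 1) →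
    (∀ j ∈ I, ∀ k ∈ I, j - k ≤ (d : ℤ) - 2) →
    ∃ G, IsFaceOf (braxQ x) G ∧ sdim G ≤ (d : ℤ) - I.card ∧
      ∀ v ∈ braxQ x, (∀ j ∈ I, v ∈ Eset d x j) → v ∈ G := by
  induction I using Finset.induction_on with
  | empty => exact fun _ _ => ⟨braxQ x, brax_faceQ x, by simp [hdim], fun v hv _ => hv⟩
  | insert a I ha ih =>
    intro hI hI2
    obtain ⟨G, hG, hGd, hGm⟩ := ih (fun j hj => hI j (Finset.mem_insert_of_mem hj))
      (fun j hj k hk => hI2 j (Finset.mem_insert_of_mem hj) k (Finset.mem_insert_of_mem hk))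
    obtain ⟨ha1, ha2⟩ := hI a (Finset.mem_insert_self _ _)
    have hEa := hE a ha1 (by omega)
    refine ⟨G ∩ convexHull ℝ (Eset d x a), brax_face_inter hG hEa, ?_, ?_⟩
    · have hmem : xc x a ∈ G := by
        refine hGm _ (brax_xc_mem x a) fun j hj => brax_memE x ?_ ?_ ?_
        · rintro rfl
          exact ha hj
        · exact hI2 _ (Finset.mem_insert_self _ _) _ (Finset.mem_insert_of_mem hj)
        · exact hI2 _ (Finset.mem_insert_of_mem hj) _ (Finset.mem_insert_self _ _)
      have := brax_cut hEa hG hmem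
        (brax_notMem hEa.1.subset (hext _) (brax_notMemE hinj (by omega) ha2))
      rw [Finset.card_insert_of_notMem ha]
      push_cast
      omega
    · intro v hv hvI
      exact ⟨hGm v hv fun j hj => hvI j (Finset.mem_insert_of_mem hj),
        subset_convexHull ℝ _ (hvI a (Finset.mem_insert_self _ _))⟩

/-- The case `S = {x_0, x_l}`. -/
lemma brax_pair {d n : ℕ} {x : Fin (n + 1) → V} (hd : 3 ≤ d) (hn : d ≤ n)
    (hinj : Function.Injective x)
    (hdim : sdim (braxQ x) = d)
    (hext : ∀ i, x i ∈ Set.extremePoints ℝ (braxQ x))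
    (hE : ∀ j : ℤ, 2 ≤ j → j ≤ n → IsFaceOf (braxQ x) (convexHull ℝ (Eset d x j)))
    (l : ℤ) (hl1 : 1 ≤ l) (hln : l ≤ n) :
    ∃ G, IsFaceOf (braxQ x) G ∧ sdim G ≤ 2 ∧ x 0 ∈ G ∧ xc x l ∈ G := by
  have hx0 : x 0 ∈ braxQ x := brax_x0 x ▸ brax_xc_mem x 0
  have hx0E : ∀ j, x 0 ∈ Eset d x j := fun j => Or.inl rfl
  have hw := brax_window hd hinj hdim hext hE
  rcases lt_or_ge ((n : ℤ) - d + 1) l with h | h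
  · rcases eq_or_ne l n with rfl | hne
    · obtain ⟨G, hG, hGd, hGm⟩ := hw (Finset.Icc ((n : ℤ) - d + 2) (n - 1))
        (by simp only [Finset.mem_Icc]; omega) (by simp only [Finset.mem_Icc]; omega)
      refine ⟨G, hG, ?_, hGm _ hx0 fun j _ => hx0E j, hGm _ (brax_xc_mem x _) fun j hj => ?_⟩
      · rw [Int.card_Icc] at hGd
        omega
      · rw [Finset.mem_Icc] at hj
        exact brax_memE x (by omega) (by omega) (by omega)
    · obtain ⟨G, hG, hGd, hGm⟩ := hw ((Finset.Icc ((n : ℤ) - d + 2) (n - 1)).erase l)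
        (by simp only [Finset.mem_erase, Finset.mem_Icc]; omega)
        (by simp only [Finset.mem_erase, Finset.mem_Icc]; omega)
      have hEn := hE n (by omega) le_rfl
      have hc := brax_cut (v := xc x ((n : ℤ) - d + 1)) hEn hG ?_ ?_
      · refine ⟨G ∩ convexHull ℝ (Eset d x n), brax_face_inter hG hEn, ?_,
          ⟨hGm _ hx0 fun j _ => hx0E j, subset_convexHull ℝ _ (hx0E _)⟩,
          ⟨hGm _ (brax_xc_mem x _) fun j hj => ?_, subset_convexHull ℝ _ ?_⟩⟩
        · rw [Finset.card_erase_of_mem (by rw [Finset.mem_Icc]; omega), Int.card_Icc] at hGd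
          omega
        · rw [Finset.mem_erase, Finset.mem_Icc] at hj
          exact brax_memE x (by omega) (by omega) (by omega)
        · exact brax_memE x (by omega) (by omega) (by omega)
      · refine hGm _ (brax_xc_mem x _) fun j hj => ?_
        rw [Finset.mem_erase, Finset.mem_Icc] at hj
        exact brax_memE x (by omega) (by omega) (by omega)
      · refine brax_notMem hEn.1.subset (hext _) ?_
        rintro (h | ⟨s, ⟨⟨hs, _⟩, _⟩, h⟩)
        · rw [brax_x0 x, brax_xc_inj hinj] at h
          omega
        · rw [brax_xc_inj hinj] at h
          omega
  · obtain ⟨G, hG, hGd, hGm⟩ := hw (Finset.Icc (l + 1) (l + d - 2))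
      (by simp only [Finset.mem_Icc]; omega) (by simp only [Finset.mem_Icc]; omega)
    refine ⟨G, hG, ?_, hGm _ hx0 fun j _ => hx0E j, hGm _ (brax_xc_mem x _) fun j hj => ?_⟩
    · rw [Int.card_Icc] at hGd
      omega
    · rw [Finset.mem_Icc] at hj
      exact brax_memE x (by omega) (by omega) (by omega)

/-- The pulling triangulation of the braxtope at `x_0` is shallow: every face
of a simplex `J_i` is contained in a face of `Q` of at most twice its
dimension. -/
theorem braxtope_triangulation_shallow (d n : ℕ) (hd : 3 ≤ d) (hn : d ≤ n)
    (x : Fin (n + 1) → V) (hx : IsBraxtope d n x) :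
    ∀ i ∈ Set.Icc (1 : ℤ) ((n : ℤ) - d + 1),
      ∀ S : Set V, S ⊆ Jverts d x i → S.Nonempty →
        ∃ G : Set V, IsFaceOf (braxQ x) G ∧ convexHull ℝ S ⊆ G ∧
          sdim G ≤ 2 * sdim (convexHull ℝ S) := by
  classical
  obtain ⟨_, hinj, hdim, hext, hfac⟩ := hx.2 hd
  have hE : ∀ j : ℤ, 2 ≤ j → j ≤ n → IsFaceOf (braxQ x) (convexHull ℝ (Eset d x j)) :=
    fun j h1 h2 => ((hfac _).2 (Or.inr ⟨j, h1, h2, rfl⟩)).1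
  rintro i ⟨hi1, hi2⟩ S hSJ hSne
  obtain ⟨hTface, hTdim⟩ := (hfac (convexHull ℝ (Tset d x i))).2
    (Or.inl ⟨i, by omega, hi2, rfl⟩)
  have hxinj : Set.InjOn (xc x) (Set.Icc i (i + (d : ℤ) - 1)) := by
    rintro s ⟨hs1, hs2⟩ t ⟨ht1, ht2⟩ h
    rw [brax_xc_inj hinj] at h
    omega
  have hTfin : (Tset d x i).Finite := (Set.finite_Icc _ _).image _
  have hTcard : (Tset d x i).ncard = d := by
    unfold Tset
    rw [hxinj.ncard_image, ← Finset.coe_Icc, Set.ncard_coe_finset, Int.card_Icc]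
    omega
  have hTne : (Tset d x i).Nonempty := ⟨_, i, ⟨le_rfl, by omega⟩, rfl⟩
  have hTind : AffineIndependent ℝ ((↑) : Tset d x i → V) := by
    apply brax_indep_of_sdim hTfin hTne
    rw [brax_sdim_hull] at hTdim
    rw [hTdim, hTcard]
  have hx0T : x 0 ∉ Tset d x i := by
    rintro ⟨s, ⟨hs1, hs2⟩, h⟩
    rw [brax_x0 x, brax_xc_inj hinj] at h
    omega
  have hx0c : x 0 ∉ convexHull ℝ (Tset d x i) := brax_notMem hTface.1.subset (hext 0) hx0T
  have hJ : Jverts d x i = insert (x 0) (Tset d x i) := rfl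
  have hJQ : Jverts d x i ⊆ braxQ x := by
    rw [hJ]
    rintro v (rfl | ⟨s, _, rfl⟩)
    · exact (hext 0).1
    · exact brax_xc_mem x s
  have hJfin : (Jverts d x i).Finite := hJ ▸ hTfin.insert _
  have hJind : AffineIndependent ℝ ((↑) : Jverts d x i → V) := by
    apply brax_indep_of_sdim hJfin ⟨_, Or.inl rfl⟩
    have hsub : convexHull ℝ (Jverts d x i) ⊆ braxQ x :=
      convexHull_min hJQ (convex_convexHull ℝ _)
    have := brax_fd (brax_fdQ x) hsub
    have hdr := brax_drop (F := convexHull ℝ (Tset d x i)) hTface.2.1 hTface.1 hsub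
      (convexHull_mono (hJ ▸ Set.subset_insert _ _))
      (subset_convexHull ℝ _ (Or.inl rfl)) hx0c
    rw [brax_sdim_hull (Jverts d x i)] at hdr
    rw [hJ, Set.ncard_insert_of_notMem hx0T hTfin, hTcard, ← hJ]
    push_cast
    omega
  have hSfin := hJfin.subset hSJ
  have hSdim : sdim (convexHull ℝ S) = (S.ncard : ℤ) - 1 := by
    rw [brax_sdim_hull]
    exact brax_indep_sdim hSfin hSne (hJind.mono hSJ)
  have hSpos := (Set.ncard_pos hSfin).2 hSne
  by_cases h0 : x 0 ∈ S
  swap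
  · -- `S` spans a face of the simplex `T_i`
    have hST : S ⊆ Tset d x i := by
      intro v hv
      rcases hJ ▸ hSJ hv with rfl | h
      · exact absurd hv h0
      · exact h
    refine ⟨convexHull ℝ S, ⟨hTface.1.trans (brax_simplex_face hTfin hTind hST),
      convex_convexHull ℝ _, hSfin.isClosed_convexHull ℝ⟩, subset_rfl, ?_⟩
    omega
  -- now x_0 lies in S
  set S' := S \ {x 0} with hS'
  have hS'card : S'.ncard + 1 = S.ncard := Set.ncard_sdiff_singleton_add_one h0 hSfin
  have hS'fin : S'.Finite := hSfin.subset Set.sdiff_subset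
  have hS'T : S' ⊆ Tset d x i := by
    rintro v ⟨hv, hv0⟩
    exact (hJ ▸ hSJ hv).resolve_left hv0
  have hcover : ∀ G : Set V, x 0 ∈ G → S' ⊆ G → S ⊆ G := by
    intro G hG hSG v hv
    by_cases hv0 : v = x 0
    · exact hv0 ▸ hG
    · exact hSG ⟨hv, hv0⟩
  rcases lt_trichotomy S'.ncard 1 with hk | hk | hk
  · have hS'e : S' = ∅ := (Set.ncard_eq_zero hS'fin).1 (by omega)
    have hSx : S = {x 0} := by
      apply Set.Subset.antisymm
      · exact hcover _ rfl (by simp [hS'e])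
      · simpa using h0
    refine ⟨convexHull ℝ S, ?_, subset_rfl, by omega⟩
    rw [hSx, convexHull_singleton]
    exact ⟨isExtreme_singleton.2 (hext 0), convex_singleton _, isClosed_singleton⟩
  · obtain ⟨v, hv⟩ := Set.ncard_eq_one.1 hk
    obtain ⟨l, ⟨hl1, hl2⟩, hl⟩ := hS'T (hv ▸ rfl : v ∈ S')
    obtain ⟨G, hG, hGd, hG0, hGl⟩ := brax_pair hd hn hinj hdim hext hE l (by omega) (by omega)
    refine ⟨G, hG, convexHull_min (hcover G hG0 ?_) hG.2.1, by omega⟩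
    rw [hv, ← hl]
    simpa using hGl
  · let W := Finset.Icc (i + 1) (i + (d : ℤ) - 2)
    obtain ⟨G, hG, hGd, hGm⟩ := brax_window hd hinj hdim hext hE
      (W.filter fun j => xc x j ∉ S')
      (by simp only [W, Finset.mem_filter, Finset.mem_Icc]; omega)
      (by simp only [W, Finset.mem_filter, Finset.mem_Icc]; omega)
    refine ⟨G, hG, convexHull_min (hcover G ?_ ?_) hG.2.1, ?_⟩
    · exact hGm _ (hext 0).1 fun j _ => Or.inl rfl
    · intro v hv
      refine hGm _ (hJQ (hSJ hv.1)) fun j hj => ?_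
      simp only [W, Finset.mem_filter, Finset.mem_Icc] at hj
      obtain ⟨l, ⟨hl1, hl2⟩, rfl⟩ := hS'T hv
      refine brax_memE x ?_ (by omega) (by omega)
      rintro rfl
      exact hj.2 hv
    · have h1 := W.card_filter_add_card_filter_not (fun j => xc x j ∈ S')
      have h2 : (W.filter fun j => xc x j ∈ S').card ≤ S'.ncard := by
        rw [← Set.ncard_coe_finset]
        refine Set.ncard_le_ncard_of_injOn (xc x) ?_ ?_ hS'fin
        · intro j hj
          exact (Finset.mem_filter.1 hj).2
        · refine hxinj.mono fun j hj => ?_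
          have := (Finset.mem_filter.1 hj).1
          simp only [W, Finset.mem_Icc] at this
          exact ⟨by omega, by omega⟩
      have h3 : W.card = d - 2 := by
        simp only [W, Int.card_Icc]
        omega
      omega
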